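/- Any weak solution (u, p) of the HHMO model satisfies: (a) (u − ψ)(x, 0) = 0 for all x ∈ ℝ; (b) 0 < u(x,t) ≤ ψ(x,t) for all x ∈ ℝ and t > 0; and (c) if u* < Ψ(α), then p(x,t) = 0 for all (x,t) with t > 0 and |x| > α*·√t, where α* > α is the unique number satisfying Ψ(α*) = u*. -/

import Mathlib

open MeasureTheory Filter Set

noncomputable section

/-- The precipitation-free self-similar solution `ψ(x,t)`. -/
def psi (α β x t : ℝ) : ℝ :=
  if 0 < t then
    (α * β / 2) * Real.exp (α ^ 2 / 4) *
      ∫ ζ in Set.Ioi (max (|x| / Real.sqrt t) α), Real.exp (-ζ ^ 2 / 4)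
  else 0

/-- The profile `Ψ(η)` in similarity coordinates. -/
def PsiP (α β η : ℝ) : ℝ :=
  (α * β / 2) * Real.exp (α ^ 2 / 4) * ∫ ζ in Set.Ioi (max η α), Real.exp (-ζ ^ 2 / 4)

/-- Regularity of a weak solution: `w` is the spatial derivative of `u - ψ`;
both are continuous on `ℝ × [0,∞)` and bounded on `ℝ × [0,T]` for every `T > 0`. -/
def AuxReg (α β : ℝ) (u w : ℝ → ℝ → ℝ) : Prop :=
  (∀ t ∈ Set.Ici (0:ℝ), ∀ x : ℝ, HasDerivAt (fun y => u y t - psi α β y t) (w x t) x) ∧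
  ContinuousOn (fun q : ℝ × ℝ => u q.1 q.2 - psi α β q.1 q.2) (Set.univ ×ˢ Set.Ici 0) ∧
  ContinuousOn (fun q : ℝ × ℝ => w q.1 q.2) (Set.univ ×ˢ Set.Ici 0) ∧
  ∀ T > (0:ℝ), ∃ C : ℝ, ∀ x : ℝ, ∀ t ∈ Set.Icc (0:ℝ) T,
    |u x t - psi α β x t| ≤ C ∧ |w x t| ≤ C

/-- A test function of class `C^{1,1}(ℝ × [0,T])`, vanishing for large `|x|` and at `t = T`,
together with its partial derivatives `φt`, `φx`. -/
def IsTestFun (T : ℝ) (φ φt φx : ℝ → ℝ → ℝ) : Prop :=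
  (∀ x : ℝ, ∀ t ∈ Set.Icc (0:ℝ) T,
    HasDerivWithinAt (fun s => φ x s) (φt x t) (Set.Icc 0 T) t) ∧
  (∀ x : ℝ, ∀ t ∈ Set.Icc (0:ℝ) T, HasDerivAt (fun y => φ y t) (φx x t) x) ∧
  ContinuousOn (fun q : ℝ × ℝ => φ q.1 q.2) (Set.univ ×ˢ Set.Icc 0 T) ∧
  ContinuousOn (fun q : ℝ × ℝ => φt q.1 q.2) (Set.univ ×ˢ Set.Icc 0 T) ∧
  ContinuousOn (fun q : ℝ × ℝ => φx q.1 q.2) (Set.univ ×ˢ Set.Icc 0 T) ∧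
  (∃ R : ℝ, ∀ x : ℝ, ∀ t ∈ Set.Icc (0:ℝ) T, R ≤ |x| → φ x t = 0) ∧
  (∀ x : ℝ, φ x T = 0)

/-- The weak form of the equation, relative to a given precipitation function `p` and
the spatial derivative `w` of `u - ψ`. -/
def WeakForm (α β : ℝ) (u p w : ℝ → ℝ → ℝ) : Prop :=
  ∀ T > (0:ℝ), ∀ φ φt φx : ℝ → ℝ → ℝ, IsTestFun T φ φt φx →
    (∫ t in Set.Ioc (0:ℝ) T, ∫ x : ℝ, φt x t * (u x t - psi α β x t))
      = ∫ t in Set.Ioc (0:ℝ) T, ∫ x : ℝ, (φx x t * w x t + p x t * u x t * φ x t)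

/-- A weak solution of the linear auxiliary problem with given precipitation function `p`. -/
def IsAuxSolution (α β : ℝ) (p u : ℝ → ℝ → ℝ) : Prop :=
  (∀ x t : ℝ, u (-x) t = u x t) ∧
  ∃ w : ℝ → ℝ → ℝ, AuxReg α β u w ∧ WeakForm α β u p w

/-- A weak solution `(u, p)` of the HHMO model. -/
def IsWeakSolution (α β ustar : ℝ) (u p : ℝ → ℝ → ℝ) : Prop :=
  (∀ x t : ℝ, u (-x) t = u x t) ∧
  (∀ x t : ℝ, p (-x) t = p x t) ∧
  Measurable (fun q : ℝ × ℝ => p q.1 q.2) ∧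
  (∀ x : ℝ, ∀ t ∈ Set.Ici (0:ℝ),
    (sSup ((fun s => u x s) '' Set.Icc 0 t) < ustar → p x t = 0) ∧
    (sSup ((fun s => u x s) '' Set.Icc 0 t) = ustar → p x t ∈ Set.Icc (0:ℝ) 1) ∧
    (ustar < sSup ((fun s => u x s) '' Set.Icc 0 t) → p x t = 1)) ∧
  (∀ x : ℝ, MonotoneOn (fun t => p x t) (Set.Ici (0:ℝ))) ∧
  ∃ w : ℝ → ℝ → ℝ, AuxReg α β u w ∧ WeakForm α β u p w

/-- Condition (P): the precipitation function depends only on `x` beyond the parabola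
`t = x²/α²`. -/
def CondP (α : ℝ) (p : ℝ → ℝ → ℝ) (pstar : ℝ → ℝ) : Prop :=
  Measurable pstar ∧
  ∀ᵐ x ∂(volume.restrict (Set.Ioi (0:ℝ))), ∀ t : ℝ, x ^ 2 / α ^ 2 < t → p x t = pstar x

/-- The admissible class `𝒜` of precipitation functions. -/
def IsAdmissible (p : ℝ → ℝ → ℝ) : Prop :=
  (∀ x t : ℝ, p (-x) t = p x t) ∧
  MeasureTheory.LocallyIntegrableOn (fun q : ℝ × ℝ => p q.1 q.2) (Set.Ioi 0 ×ˢ Set.Ici 0) ∧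
  ∀ T > (0:ℝ), ∃ R : ℝ, ∀ x ≥ R, ∀ t ∈ Set.Icc (0:ℝ) T, p x t = 0

/-- `u` converges uniformly, in parabolic similarity coordinates, to the profile `Φ`. -/
def ConvUnif (u : ℝ → ℝ → ℝ) (Φ : ℝ → ℝ) : Prop :=
  ∀ ε > (0:ℝ), ∃ T : ℝ, ∀ t ≥ T, ∀ η ≥ (0:ℝ), |u (η * Real.sqrt t) t - Φ η| < ε

/-- The error function. -/
def erf (x : ℝ) : ℝ := (2 / Real.sqrt Real.pi) * ∫ s in (0:ℝ)..x, Real.exp (-s ^ 2)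

/-- The complementary error function. -/
def erfc (x : ℝ) : ℝ := (2 / Real.sqrt Real.pi) * ∫ s in Set.Ioi x, Real.exp (-s ^ 2)

/-- Kummer's confluent hypergeometric function `M(a,b,z)` (real arguments). -/
def kummerM (a b z : ℝ) : ℝ :=
  ∑' n : ℕ, (Polynomial.eval a (ascPochhammer ℝ n) / Polynomial.eval b (ascPochhammer ℝ n))
    * z ^ n / (n.factorial : ℝ)

/-- `κ = (1 + √(4γ+1))/2`, the positive root of `κ(κ-1) = γ`. -/
def kappaOf (γ : ℝ) : ℝ := (1 + Real.sqrt (4 * γ + 1)) / 2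

/-- The value `u*_γ` determined by the derivative matching condition. -/
def ustarGamma (α β γ : ℝ) : ℝ :=
  (α * β / 2) *
    (kappaOf γ * kummerM (kappaOf γ / 2 + 1) (kappaOf γ + 1 / 2) (-α ^ 2 / 4) /
        (α * kummerM (kappaOf γ / 2) (kappaOf γ + 1 / 2) (-α ^ 2 / 4)) +
      Real.exp (-α ^ 2 / 4) / (Real.sqrt Real.pi * erfc (α / 2)))⁻¹

/-- The self-similar profile `Φ_γ`. -/
def Phi (α β γ η : ℝ) : ℝ :=
  if η < α then
    ustarGamma α β γ * η ^ kappaOf γ *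
      kummerM (kappaOf γ / 2) (kappaOf γ + 1 / 2) (-η ^ 2 / 4) /
      (α ^ kappaOf γ * kummerM (kappaOf γ / 2) (kappaOf γ + 1 / 2) (-α ^ 2 / 4))
  else ustarGamma α β γ * erfc (η / 2) / erfc (α / 2)


open scoped Topology Convolution in
/-- Differentiation of a convolution with a smooth compactly supported kernel. -/
lemma hasFDerivAt_integral_mul_comp_sub {v k : ℝ × ℝ → ℝ} (hv : Continuous v)
    (hk : ContDiff ℝ 1 k) (hc : HasCompactSupport k) (q : ℝ × ℝ) :
    ∃ L : ℝ × ℝ →L[ℝ] ℝ, HasFDerivAt (fun q => ∫ y, v y * k (q - y)) L q ∧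
      ∀ e, L e = ∫ y, v y * fderiv ℝ k (q - y) e := by
  have h := hc.hasFDerivAt_convolution_right (ContinuousLinearMap.mul ℝ ℝ)
    (hv.locallyIntegrable (μ := volume)) hk q
  refine ⟨_, h, fun e => ?_⟩
  rw [convolution_precompR_apply _ hv.locallyIntegrable (hc.fderiv ℝ)
    (hk.continuous_fderiv one_ne_zero)]
  rfl

lemma hasDerivAt_integral_mul_comp_sub_fst {v k : ℝ × ℝ → ℝ} (hv : Continuous v)
    (hk : ContDiff ℝ 1 k) (hc : HasCompactSupport k) (x t : ℝ) :
    HasDerivAt (fun x => ∫ y, v y * k ((x, t) - y))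
      (∫ y, v y * fderiv ℝ k ((x, t) - y) (1, 0)) x := by
  obtain ⟨L, hL, hLe⟩ := hasFDerivAt_integral_mul_comp_sub hv hk hc (x, t)
  rw [← hLe]
  exact hL.comp_hasDerivAt x ((hasDerivAt_id x).prodMk (hasDerivAt_const x t))

lemma hasDerivAt_integral_mul_comp_sub_snd {v k : ℝ × ℝ → ℝ} (hv : Continuous v)
    (hk : ContDiff ℝ 1 k) (hc : HasCompactSupport k) (x t : ℝ) :
    HasDerivAt (fun t => ∫ y, v y * k ((x, t) - y))
      (∫ y, v y * fderiv ℝ k ((x, t) - y) (0, 1)) t := by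
  obtain ⟨L, hL, hLe⟩ := hasFDerivAt_integral_mul_comp_sub hv hk hc (x, t)
  rw [← hLe]
  exact hL.comp_hasDerivAt t ((hasDerivAt_const t x).prodMk (hasDerivAt_id t))

lemma continuous_integral_mul_comp_sub {v k : ℝ × ℝ → ℝ} (hv : Continuous v)
    (hk : ContDiff ℝ 1 k) (hc : HasCompactSupport k) :
    Continuous (fun q => ∫ y, v y * k (q - y)) :=
  continuous_iff_continuousAt.2 fun q => by
    obtain ⟨L, hL, -⟩ := hasFDerivAt_integral_mul_comp_sub hv hk hc q
    exact hL.continuousAt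

lemma nonneg_of_isLocalMin_of_hasDerivAt {g g' : ℝ → ℝ} {g'' x : ℝ} (hmin : IsLocalMin g x)
    (h1 : ∀ y, HasDerivAt g (g' y) y) (h2 : HasDerivAt g' g'' x) : 0 ≤ g'' := by
  by_contra! hneg
  have hd : deriv g = g' := funext fun y => (h1 y).deriv
  have hmax : IsLocalMax g x := isLocalMax_of_deriv_deriv_neg (by rw [hd, h2.deriv]; exact hneg)
    hmin.deriv_eq_zero (h1 x).continuousAt
  have hconst : g =ᶠ[nhds x] fun _ => g x := by
    filter_upwards [hmin, hmax] with y hy hy' using le_antisymm hy' hy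
  have h0 : g' =ᶠ[nhds x] fun _ => 0 := by
    filter_upwards [hconst.eventually_nhds] with y hy
    rw [← (h1 y).deriv, Filter.EventuallyEq.deriv_eq hy, deriv_const]
  have : g'' = 0 := by rw [← h2.deriv, h0.deriv_eq, deriv_const]
  linarith

lemma nonpos_of_hasDerivAt_of_left_min {g : ℝ → ℝ} {g' t r : ℝ} (hr : r < t)
    (hmin : ∀ s ∈ Ioo r t, g t ≤ g s) (h : HasDerivAt g g' t) : g' ≤ 0 := by
  have h' := hasDerivWithinAt_iff_tendsto_slope' (s := Iio t) (by simp) |>.1 h.hasDerivWithinAt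
  refine le_of_tendsto h' ?_
  filter_upwards [Ioo_mem_nhdsLT hr] with s hs
  rw [slope_def_field]
  exact div_nonpos_of_nonneg_of_nonpos (sub_nonneg.2 (hmin s hs)) (by linarith [hs.2])

/-- A weak solution of `v_t = v_xx + f` with `w = v_x`, on the half plane `t > 0`. -/
structure IsWeakHeatSol (v w f : ℝ × ℝ → ℝ) : Prop where
  cont_v : Continuous v
  cont_w : Continuous w
  hasDerivAt : ∀ x t, HasDerivAt (fun y => v (y, t)) (w (x, t)) x
  meas_f : Measurable f
  bdd_f : ∀ T > 0, ∃ C, ∀ x, ∀ t ∈ Ioc (0 : ℝ) T, |f (x, t)| ≤ C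
  weak : ∀ T > 0, ∀ φ φt φx : ℝ → ℝ → ℝ, IsTestFun T φ φt φx →
    (∫ t in Ioc (0 : ℝ) T, ∫ x : ℝ, φt x t * v (x, t))
      = ∫ t in Ioc (0 : ℝ) T, ∫ x : ℝ, (φx x t * w (x, t) - f (x, t) * φ x t)

lemma IsWeakHeatSol.neg {v w f : ℝ × ℝ → ℝ} (h : IsWeakHeatSol v w f) :
    IsWeakHeatSol (fun q => -v q) (fun q => -w q) (fun q => -f q) where
  cont_v := h.cont_v.neg
  cont_w := h.cont_w.neg
  hasDerivAt x t := (h.hasDerivAt x t).neg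
  meas_f := h.meas_f.neg
  bdd_f T hT := by simpa using h.bdd_f T hT
  weak T hT φ φt φx hφ := by
    have := h.weak T hT φ φt φx hφ
    have e : ∀ x t, φx x t * -w (x, t) - -f (x, t) * φ x t
      = -(φx x t * w (x, t) - f (x, t) * φ x t) := fun x t => by ring
    simp only [e]
    simp only [mul_neg, integral_neg, this]

lemma setIntegral_Ioc_integral_eq {F : ℝ × ℝ → ℝ} {T : ℝ} (hF : Integrable F)
    (h0 : ∀ x t, t ∉ Ioc 0 T → F (x, t) = 0) :
    ∫ t in Ioc 0 T, ∫ x, F (x, t) = ∫ q, F q := by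
  rw [setIntegral_eq_integral_of_forall_compl_eq_zero (fun t ht => by simp [h0 _ t ht])]
  exact (integral_prod_symm F hF).symm

lemma fderiv_eq_zero_of_lt_norm {k : ℝ × ℝ → ℝ} {ε : ℝ}
    (hsupp : ∀ y, ε < ‖y‖ → k y = 0) {y : ℝ × ℝ} (hy : ε < ‖y‖) : fderiv ℝ k y = 0 := by
  have : k =ᶠ[nhds y] fun _ => 0 := by
    filter_upwards [continuous_norm.continuousAt.eventually (lt_mem_nhds hy)] with z hz
      using hsupp z hz
  rw [this.fderiv_eq]
  simp

lemma hasCompactSupport_of_eq_zero_of_lt_norm {k : ℝ × ℝ → ℝ} {ε : ℝ}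
    (hsupp : ∀ y, ε < ‖y‖ → k y = 0) : HasCompactSupport k :=
  HasCompactSupport.intro (isCompact_closedBall 0 ε) fun y hy => hsupp y (by simpa using hy)

/-- Testing the weak heat equation against a translated kernel. -/
lemma IsWeakHeatSol.integral_kernel {v w f : ℝ × ℝ → ℝ} (h : IsWeakHeatSol v w f)
    {k : ℝ × ℝ → ℝ} {ε x t : ℝ} (hk : ContDiff ℝ 2 k) (hsupp : ∀ y, ε < ‖y‖ → k y = 0)
    (hε : 0 < ε) (ht : ε < t) :
    Integrable (fun y => f y * k ((x, t) - y)) ∧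
    ∫ y, v y * fderiv ℝ k ((x, t) - y) (0, 1) =
      (∫ y, v y * fderiv ℝ (fun z => fderiv ℝ k z (1, 0)) ((x, t) - y) (1, 0)) +
        ∫ y, f y * k ((x, t) - y) := by
  set kx : ℝ × ℝ → ℝ := fun z => fderiv ℝ k z (1, 0) with hkx
  have hkx1 : ContDiff ℝ 1 kx := (hk.fderiv_right (m := 1) (by norm_num)).clm_apply contDiff_const
  have hk1 : ContDiff ℝ 1 k := hk.of_le (by norm_num)
  have hsuppx : ∀ y, ε < ‖y‖ → kx y = 0 := fun y hy => by
    simp [hkx, fderiv_eq_zero_of_lt_norm hsupp hy]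
  have hdk : Continuous (fderiv ℝ k) := hk1.continuous_fderiv one_ne_zero
  have hdkx : Continuous (fderiv ℝ kx) := hkx1.continuous_fderiv one_ne_zero
  have hfar : ∀ y s : ℝ, (ε < |y - x| ∨ s ∉ Ioc 0 (t + ε + 1)) → ε < ‖(x, t) - (y, s)‖ := by
    intro y s hys
    rw [Prod.mk_sub_mk, Prod.norm_mk, lt_max_iff, Real.norm_eq_abs, Real.norm_eq_abs]
    rcases hys with hy | hs
    · left; rwa [abs_sub_comm]
    · right
      rw [mem_Ioc, not_and_or, not_lt, not_le] at hs
      rcases hs with hs | hs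
      · exact lt_of_lt_of_le (by linarith) (le_abs_self _)
      · exact lt_of_lt_of_le (by linarith) (neg_le_abs _)
  have hcs : ∀ g : ℝ × ℝ → ℝ, (∀ y, ε < ‖y‖ → g y = 0) → 
      HasCompactSupport fun y => g ((x, t) - y) := fun g hg =>
    (hasCompactSupport_of_eq_zero_of_lt_norm hg).comp_homeomorph (Homeomorph.subLeft (x, t))
  have hcs1 : ∀ g : ℝ × ℝ → ℝ, (∀ y, ε < ‖y‖ → g y = 0) → ∀ s,
      HasCompactSupport fun y => g ((x, t) - (y, s)) := fun g hg s =>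
    HasCompactSupport.intro (isCompact_closedBall x ε) fun y hy =>
      hg _ (hfar y s (Or.inl (by simpa [Real.dist_eq] using hy)))
  have hline : ∀ (g : ℝ × ℝ → ℝ), ContDiff ℝ 1 g → ∀ y s,
      HasDerivAt (fun y => g ((x, t) - (y, s))) (-fderiv ℝ g ((x, t) - (y, s)) (1, 0)) y := by
    intro g hg y s
    have h1 := ((hg.differentiable one_ne_zero) ((x, t) - (y, s))).hasFDerivAt
    have h2 : HasDerivAt (fun y : ℝ => (x, t) - (y, s)) (-(1, 0)) y :=
      ((hasDerivAt_id y).prodMk (hasDerivAt_const y s)).const_sub _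
    simpa only [map_neg] using! h1.comp_hasDerivAt y h2
  have hline2 : ∀ y s,
      HasDerivAt (fun s => k ((x, t) - (y, s))) (-fderiv ℝ k ((x, t) - (y, s)) (0, 1)) s := by
    intro y s
    have h1 := ((hk1.differentiable one_ne_zero) ((x, t) - (y, s))).hasFDerivAt
    have h2 : HasDerivAt (fun s : ℝ => (x, t) - (y, s)) (-(0, 1)) s :=
      ((hasDerivAt_const s y).prodMk (hasDerivAt_id s)).const_sub _
    simpa only [map_neg] using! h1.comp_hasDerivAt s h2
  have hT : 0 < t + ε + 1 := by linarith
  have htest : IsTestFun (t + ε + 1) (fun y s => k ((x, t) - (y, s)))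
      (fun y s => -fderiv ℝ k ((x, t) - (y, s)) (0, 1))
      (fun y s => -kx ((x, t) - (y, s))) := by
    refine ⟨fun y s _ => (hline2 y s).hasDerivWithinAt, fun y s _ => hline k hk1 y s,
      ?_, ?_, ?_, ⟨ε + 1 + |x|, fun y s _ hy => hsupp _ (hfar y s (Or.inl ?_))⟩,
      fun y => hsupp _ ?_⟩
    · exact Continuous.continuousOn (by have := hk1.continuous; fun_prop)
    · exact Continuous.continuousOn (by fun_prop)
    · exact Continuous.continuousOn (by have := hkx1.continuous; fun_prop)
    · have := abs_sub_abs_le_abs_sub y x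
      linarith
    · rw [Prod.mk_sub_mk, Prod.norm_mk, lt_max_iff]
      right
      rw [Real.norm_eq_abs]
      exact lt_of_lt_of_le (by linarith) (neg_le_abs _)
  have hzero : ∀ g : ℝ × ℝ → ℝ, (∀ y, ε < ‖y‖ → g y = 0) → ∀ y s, s ∉ Ioc 0 (t + ε + 1) →
      g ((x, t) - (y, s)) = 0 := fun g hg y s hs => hg _ (hfar y s (Or.inr hs))
  have hconv : ∀ a g : ℝ × ℝ → ℝ, Continuous a → Continuous g → (∀ y, ε < ‖y‖ → g y = 0) →
      Integrable fun y => a y * g ((x, t) - y) := fun a g ha hg hg0 =>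
    (ha.mul (by fun_prop)).integrable_of_hasCompactSupport (hcs g hg0).mul_left
  have hkt0 : ∀ y, ε < ‖y‖ → fderiv ℝ k y (0, 1) = 0 := fun y hy => by
    simp [fderiv_eq_zero_of_lt_norm hsupp hy]
  have hkxx0 : ∀ y, ε < ‖y‖ → fderiv ℝ kx y (1, 0) = 0 := fun y hy => by
    simp [fderiv_eq_zero_of_lt_norm hsuppx hy]
  have hkt := hconv v (fun y => fderiv ℝ k y (0, 1)) h.cont_v (by fun_prop) hkt0
  have hwx := hconv w kx h.cont_w hkx1.continuous hsuppx
  have hvxx := hconv v (fun y => fderiv ℝ kx y (1, 0)) h.cont_v (by fun_prop) hkxx0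
  have hfk : Integrable fun y => f y * k ((x, t) - y) := by
    obtain ⟨C, hC⟩ := h.bdd_f _ hT
    refine (hconv (fun _ => C) (fun y => |k y|) continuous_const hk1.continuous.abs
      (fun y hy => by simp [hsupp y hy])).mono'
      (h.meas_f.mul (hk1.continuous.measurable.comp
        (measurable_const.sub measurable_id))).aestronglyMeasurable (.of_forall ?_)
    rintro ⟨y, s⟩
    by_cases hs : s ∈ Ioc 0 (t + ε + 1)
    · rw [norm_mul, Real.norm_eq_abs, Real.norm_eq_abs]
      exact mul_le_mul_of_nonneg_right (hC y s hs) (abs_nonneg _)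
    · simp [-Prod.mk_sub_mk, hzero k hsupp y s hs]
  refine ⟨hfk, ?_⟩
  have hweak := h.weak _ hT _ _ _ htest
  have hL := setIntegral_Ioc_integral_eq (T := t + ε + 1) hkt.neg
    (fun y s hs => by simp [-Prod.mk_sub_mk, hzero _ hkt0 y s hs])
  have hR := setIntegral_Ioc_integral_eq (T := t + ε + 1) (hwx.neg.sub hfk)
    (fun y s hs => by simp [-Prod.mk_sub_mk, hzero _ hsupp y s hs, hzero _ hsuppx y s hs])
  have hibp : ∀ s, ∫ y, w (y, s) * kx ((x, t) - (y, s)) =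
      ∫ y, v (y, s) * fderiv ℝ kx ((x, t) - (y, s)) (1, 0) := by
    intro s
    have hi : ∀ a g : ℝ × ℝ → ℝ, Continuous a → Continuous g → (∀ y, ε < ‖y‖ → g y = 0) →
        Integrable fun y => a (y, s) * g ((x, t) - (y, s)) := fun a g ha hg hg0 =>
      Continuous.integrable_of_hasCompactSupport (by fun_prop) (hcs1 g hg0 s).mul_left
    have := integral_mul_deriv_eq_deriv_mul_of_integrable
      (u := fun y => v (y, s)) (v := fun y => kx ((x, t) - (y, s)))
      (u' := fun y => w (y, s)) (v' := fun y => -fderiv ℝ kx ((x, t) - (y, s)) (1, 0))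
      (fun y _ => h.hasDerivAt y s) (fun y _ => hline kx hkx1 y s)
      (by simpa [Pi.mul_def] using (hi v (fun y => fderiv ℝ kx y (1, 0)) h.cont_v
        (by fun_prop) hkxx0).neg)
      (hi w kx h.cont_w hkx1.continuous hsuppx) (hi v kx h.cont_v hkx1.continuous hsuppx)
    simp only [mul_neg, integral_neg, neg_inj] at this
    exact this.symm
  have hwv : ∫ y, w y * kx ((x, t) - y) = ∫ y, v y * fderiv ℝ kx ((x, t) - y) (1, 0) :=
    calc _ = ∫ s, ∫ y, w (y, s) * kx ((x, t) - (y, s)) := integral_prod_symm _ hwx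
      _ = ∫ s, ∫ y, v (y, s) * fderiv ℝ kx ((x, t) - (y, s)) (1, 0) := by simp_rw [hibp]
      _ = _ := (integral_prod_symm _ hvxx).symm
  have hcombine : ∫ q, (-fun y => v y * fderiv ℝ k ((x, t) - y) (0, 1)) q =
      ∫ q, ((-fun y => w y * kx ((x, t) - y)) - fun y => f y * k ((x, t) - y)) q := by
    rw [← hL, ← hR]
    convert! hweak using 5
    · simp [mul_comm]
    · simp [mul_comm]
  rw [integral_sub' hwx.neg hfk, integral_neg', integral_neg', hwv] at hcombine
  linarith

lemma integral_mul_normed_bump_sub (b : ContDiffBump (0 : ℝ × ℝ)) (g : ℝ × ℝ → ℝ) (q : ℝ × ℝ) :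
    ∫ y, g y * b.normed volume (q - y) = ∫ y, b.normed volume y * g (q - y) := by
  rw [← integral_sub_left_eq_self _ volume q]
  simp [mul_comm]

/-- `φ` is differentiable in time and twice differentiable in space for `t > 0`, with the given
partial derivatives. -/
structure HasParabolicDerivs (φ φt φx φxx : ℝ → ℝ → ℝ) : Prop where
  hasDerivAt_t : ∀ x, ∀ t > 0, HasDerivAt (fun s => φ x s) (φt x t) t
  hasDerivAt_x : ∀ x, ∀ t > 0, HasDerivAt (fun y => φ y t) (φx x t) x
  hasDerivAt_xx : ∀ x, ∀ t > 0, HasDerivAt (fun y => φx y t) (φxx x t) x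
  continuousOn : ContinuousOn (fun q : ℝ × ℝ => φ q.1 q.2) {q | 0 < q.2}

open scoped Topology in
/-- Weak supersolutions are viscosity supersolutions: a smooth function touching a weak solution
of `v_t = v_xx + f` from below in the past satisfies the corresponding pointwise inequality. -/
lemma IsWeakHeatSol.le_of_touching {v w f : ℝ × ℝ → ℝ} (h : IsWeakHeatSol v w f)
    {φ φt φx φxx : ℝ → ℝ → ℝ} (hφ : HasParabolicDerivs φ φt φx φxx)
    {x₀ t₀ m : ℝ} (ht₀ : 0 < t₀)
    (hl : ContinuousAt (fun q : ℝ × ℝ => φt q.1 q.2 - φxx q.1 q.2) (x₀, t₀))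
    (hf : ∀ᶠ q in 𝓝 (x₀, t₀), m ≤ f q)
    (hmin : ∀ᶠ q in 𝓝 (x₀, t₀), q.2 ≤ t₀ → v (x₀, t₀) - φ x₀ t₀ ≤ v q - φ q.1 q.2) :
    m ≤ φt x₀ t₀ - φxx x₀ t₀ := by
  by_contra! hlt
  have hl' : ∀ᶠ q in 𝓝 (x₀, t₀),
      φt q.1 q.2 - φxx q.1 q.2 - 2 * (q.2 - t₀) + 12 * (q.1 - x₀) ^ 2 < m := by
    have hc : ContinuousAt (fun q : ℝ × ℝ =>
        φt q.1 q.2 - φxx q.1 q.2 - 2 * (q.2 - t₀) + 12 * (q.1 - x₀) ^ 2) (x₀, t₀) :=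
      (hl.sub (by fun_prop)).add (by fun_prop)
    exact hc.eventually (gt_mem_nhds (by simpa using hlt))
  obtain ⟨R, hR, hball⟩ := Metric.eventually_nhds_iff.1 (hf.and (hmin.and hl'))
  obtain ⟨r, hr, hrR, hrt⟩ : ∃ r > 0, 2 * r < R ∧ 2 * r < t₀ :=
    ⟨min R t₀ / 3, by positivity, by linarith [min_le_left R t₀], by linarith [min_le_right R t₀]⟩
  set K : Set (ℝ × ℝ) := Icc (x₀ - r) (x₀ + r) ×ˢ Icc (t₀ - r) t₀ with hK
  have hKc : IsCompact K := isCompact_Icc.prod isCompact_Icc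
  have hKd : ∀ q ∈ K, dist q (x₀, t₀) ≤ r := by
    rintro ⟨x, t⟩ ⟨hx, ht⟩
    simp only [mem_Icc] at hx ht
    rw [Prod.dist_eq, Real.dist_eq, Real.dist_eq]
    exact max_le (abs_le.2 ⟨by linarith, by linarith⟩) (abs_le.2 ⟨by linarith, by linarith⟩)
  have hKpos : ∀ q ∈ K, 0 < q.2 := fun q hq => by linarith [hq.2.1]
  set d : ℝ := min (r ^ 4) (r ^ 2) with hd
  have hdpos : 0 < d := by positivity
  obtain ⟨δ, hδ, huc⟩ := Metric.uniformContinuousOn_iff.1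
    ((isCompact_closedBall (x₀, t₀) (2 * r)).uniformContinuousOn_of_continuous
      h.cont_v.continuousOn) (d / 3) (by positivity)
  set ε : ℝ := min δ r with hε
  have hεpos : 0 < ε := lt_min hδ hr
  have hεδ : ε ≤ δ := min_le_left _ _
  have hεr : ε ≤ r := min_le_right _ _
  let b : ContDiffBump (0 : ℝ × ℝ) := ⟨ε / 2, ε, by positivity, by linarith⟩
  set k : ℝ × ℝ → ℝ := b.normed volume with hk
  have hk2 : ContDiff ℝ 2 k := b.contDiff_normed (n := 2)
  have hk1 : ContDiff ℝ 1 k := hk2.of_le (by norm_num)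
  have hk0 : ∀ y, 0 ≤ k y := b.nonneg_normed
  have hsupp' : ∀ y, ε ≤ ‖y‖ → k y = 0 := fun y hy => by
    have : y ∉ Function.support k := by
      rw [hk, b.support_normed_eq]
      simpa using hy
    simpa using this
  have hsupp : ∀ y, ε < ‖y‖ → k y = 0 := fun y hy => hsupp' y hy.le
  have hkc : HasCompactSupport k := hasCompactSupport_of_eq_zero_of_lt_norm hsupp
  have hkxc : HasCompactSupport (fun z => fderiv ℝ k z (1, 0)) :=
    hasCompactSupport_of_eq_zero_of_lt_norm (ε := ε) fun y hy => by
      simp [fderiv_eq_zero_of_lt_norm hsupp hy]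
  have hkx1 : ContDiff ℝ 1 (fun z => fderiv ℝ k z (1, 0)) :=
    (hk2.fderiv_right (m := 1) (by norm_num)).clm_apply contDiff_const
  have hVv : ∀ q ∈ K, |(∫ y, v y * k (q - y)) - v q| ≤ d / 3 := by
    intro q hq
    rw [hk, integral_mul_normed_bump_sub]
    have := b.dist_normed_convolution_le (μ := volume) (g := v) (x₀ := q) (ε := d / 3)
      h.cont_v.aestronglyMeasurable fun y hy => ?_
    · rwa [Real.dist_eq] at this
    · have hy' : dist y q < ε := hy
      have hqd := hKd q hq
      refine (huc y ?_ q ?_ (hy'.trans_le hεδ)).le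
      · exact (dist_triangle y q _).trans (by linarith)
      · exact hqd.trans (by linarith)
  set D : ℝ × ℝ → ℝ := fun q => (∫ y, v y * k (q - y)) - φ q.1 q.2 +
    ((q.1 - x₀) ^ 4 + (q.2 - t₀) ^ 2) with hD
  have hDc : ContinuousOn D K :=
    ((continuous_integral_mul_comp_sub h.cont_v hk1 hkc).continuousOn.sub
      (hφ.continuousOn.mono hKpos)).add (by fun_prop)
  have hq0K : (x₀, t₀) ∈ K := ⟨⟨by simp [hr.le], by simp [hr.le]⟩, by simp [hr.le], le_rfl⟩
  obtain ⟨⟨x, t⟩, hqK, hqmin⟩ := hKc.exists_isMinOn ⟨_, hq0K⟩ hDc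
  have hxK := hqK.1
  have htK := hqK.2
  simp only [mem_Icc] at hxK htK
  have htpos : 0 < t := hKpos _ hqK
  have hsmall : (x - x₀) ^ 4 + (t - t₀) ^ 2 < d := by
    have h1 := hqmin hq0K
    simp only [hD, mem_ofPred_eq, sub_self] at h1
    have h2 := abs_le.1 (hVv _ hq0K)
    have h3 := abs_le.1 (hVv _ hqK)
    have h4 := (hball ((hKd _ hqK).trans_lt (by linarith))).2.1 htK.2
    simp only at h4
    norm_num at h1
    linarith [h2.1, h2.2, h3.1, h3.2]
  have hxlt : |x - x₀| < r := by
    by_contra! hge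
    have : r ^ 4 ≤ (x - x₀) ^ 4 := by
      rw [← (show Even 4 by decide).pow_abs (x - x₀)]
      exact pow_le_pow_left₀ hr.le hge 4
    linarith [min_le_left (r ^ 4) (r ^ 2), sq_nonneg (t - t₀)]
  have htlt : t₀ - r < t := by
    by_contra! hge
    have : r ^ 2 ≤ (t - t₀) ^ 2 := by nlinarith
    have h4 : 0 ≤ (x - x₀) ^ 4 := by positivity
    linarith [min_le_right (r ^ 4) (r ^ 2)]
  obtain ⟨hfk, hid⟩ := h.integral_kernel (x := x) (t := t) hk2 hsupp hεpos (by linarith)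
  have hxx : 0 ≤ (∫ y, v y * fderiv ℝ (fun z => fderiv ℝ k z (1, 0)) ((x, t) - y) (1, 0)) -
      φxx x t + 12 * (x - x₀) ^ 2 := by
    refine nonneg_of_isLocalMin_of_hasDerivAt (g := fun x => D (x, t)) (x := x)
      (g' := fun x => (∫ y, v y * fderiv ℝ k ((x, t) - y) (1, 0)) - φx x t + 4 * (x - x₀) ^ 3)
      ?_ (fun y => ?_) ?_
    · have hnhds : ∀ᶠ y in 𝓝 x, |y - x₀| < r :=
        (by fun_prop : ContinuousAt (fun y => |y - x₀|) x).eventually (gt_mem_nhds hxlt)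
      filter_upwards [hnhds] with y hy
      rw [abs_lt] at hy
      exact hqmin ⟨⟨by linarith [hy.1], by linarith [hy.2]⟩, hqK.2⟩
    · have hpow : HasDerivAt (fun y : ℝ => (y - x₀) ^ 4 + (t - t₀) ^ 2) (4 * (y - x₀) ^ 3) y := by
        simpa using (((hasDerivAt_id y).sub_const x₀).pow 4).add_const ((t - t₀) ^ 2)
      exact ((hasDerivAt_integral_mul_comp_sub_fst h.cont_v hk1 hkc y t).sub
        (hφ.hasDerivAt_x y t htpos)).add hpow
    · have hpow : HasDerivAt (fun y : ℝ => 4 * (y - x₀) ^ 3) (12 * (x - x₀) ^ 2) x := by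
        convert! (((hasDerivAt_id x).sub_const x₀).pow 3).const_mul 4 using 1
        simp; ring
      exact ((hasDerivAt_integral_mul_comp_sub_fst h.cont_v hkx1 hkxc x t).sub
        (hφ.hasDerivAt_xx x t htpos)).add hpow
  have htt : (∫ y, v y * fderiv ℝ k ((x, t) - y) (0, 1)) - φt x t + 2 * (t - t₀) ≤ 0 := by
    refine nonpos_of_hasDerivAt_of_left_min (g := fun t => D (x, t)) htlt (fun s hs => ?_) ?_
    · exact hqmin ⟨hqK.1, hs.1.le, hs.2.le.trans htK.2⟩
    · have hpow : HasDerivAt (fun s : ℝ => (x - x₀) ^ 4 + (s - t₀) ^ 2) (2 * (t - t₀)) t := by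
        simpa using (((hasDerivAt_id t).sub_const t₀).pow 2).const_add ((x - x₀) ^ 4)
      exact ((hasDerivAt_integral_mul_comp_sub_snd h.cont_v hk1 hkc x t).sub
        (hφ.hasDerivAt_t x t htpos)).add hpow
  have hm : m ≤ ∫ y, f y * k ((x, t) - y) := by
    have hone : ∫ y, m * k ((x, t) - y) = m := by
      rw [integral_const_mul, integral_sub_left_eq_self, b.integral_normed, mul_one]
    rw [← hone]
    refine integral_mono ((b.integrable_normed.comp_sub_left (x, t)).const_mul m) hfk fun y => ?_
    by_cases hy : ε ≤ ‖(x, t) - y‖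
    · simp [-Prod.mk_sub_mk, hsupp' _ hy]
    · refine mul_le_mul_of_nonneg_right (hball ?_).1 (hk0 _)
      rw [← dist_eq_norm, dist_comm] at hy
      have := hKd _ hqK
      exact (dist_triangle y (x, t) _).trans_lt (by linarith)
  have := (hball ((hKd _ hqK).trans_lt (by linarith))).2.2
  simp only at this
  linarith

lemma IsWeakHeatSol.initial_nonpos {v w f : ℝ × ℝ → ℝ} (h : IsWeakHeatSol v w f) (x₀ : ℝ) :
    v (x₀, 0) ≤ 0 := by
  by_contra! ha
  set a := v (x₀, 0) with ha'
  obtain ⟨δ, hδ, hball⟩ := Metric.eventually_nhds_iff.1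
    (h.cont_v.continuousAt.eventually (lt_mem_nhds (half_lt_self ha)))
  let g : ContDiffBump x₀ := ⟨δ / 4, δ / 2, by positivity, by linarith⟩
  have hg1 : ContDiff ℝ 1 g := g.contDiff (n := 1)
  have hgfar : ∀ y, y ∉ Icc (x₀ - δ) (x₀ + δ) → g y = 0 := by
    intro y hy
    refine g.zero_of_le_dist ?_
    by_contra! hlt
    rw [show g.rOut = δ / 2 from rfl, Real.dist_eq, abs_lt] at hlt
    exact hy ⟨by linarith [hlt.1], by linarith [hlt.2]⟩
  have hg'far : ∀ y, y ∉ Icc (x₀ - δ) (x₀ + δ) → deriv g y = 0 := by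
    intro y hy
    have : g =ᶠ[nhds y] fun _ => 0 := by
      filter_upwards [isClosed_Icc.isOpen_compl.mem_nhds hy] with z hz using hgfar z hz
    rw [this.deriv_eq, deriv_const]
  have hg'c : Continuous (deriv g) := hg1.continuous_deriv le_rfl
  set I := ∫ y, g y with hI
  have hIpos : 0 < I := g.integral_pos
  obtain ⟨M, hM⟩ := (isCompact_Icc (a := x₀ - δ) (b := x₀ + δ)).prod
    (isCompact_Icc (a := (0 : ℝ)) (b := 1)) |>.exists_bound_of_continuousOn
      (f := fun q : ℝ × ℝ => deriv g q.1 * w q) (by have := h.cont_w; fun_prop)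
  obtain ⟨F, hF⟩ := h.bdd_f 1 one_pos
  have key : ∀ T, 0 < T → T < δ → T ≤ 1 → a / 2 * I ≤ (M + F) * (2 * δ) * T := by
    intro T hT hTδ hT1
    have htest : IsTestFun T (fun y s => g y * (T - s)) (fun y s => -g y)
        (fun y s => deriv g y * (T - s)) := by
      refine ⟨fun y s _ => ?_, fun y s _ => ?_, ?_, ?_, ?_, ⟨δ + 1 + |x₀|, fun y s _ hy => ?_⟩,
        fun y => by simp⟩
      · have := ((hasDerivAt_id s).const_sub T).const_mul (g y)
        simpa using this.hasDerivWithinAt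
      · exact (hg1.differentiable one_ne_zero y).hasDerivAt.mul_const _
      · exact Continuous.continuousOn (by have := g.continuous; fun_prop)
      · exact Continuous.continuousOn (by have := g.continuous; fun_prop)
      · exact Continuous.continuousOn (by fun_prop)
      · beta_reduce
        rw [hgfar y, zero_mul]
        intro hy'
        have h1 := abs_sub_abs_le_abs_sub y x₀
        have h2 : |y - x₀| ≤ δ := abs_le.2 ⟨by linarith [hy'.1], by linarith [hy'.2]⟩
        linarith
    have hweak := h.weak T hT _ _ _ htest
    have hJ : ∀ s, ∫ y, g y * v (y, s) = ∫ y in Icc (x₀ - δ) (x₀ + δ), g y * v (y, s) :=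
      fun s => (setIntegral_eq_integral_of_forall_compl_eq_zero
        fun y hy => by rw [hgfar y hy, zero_mul]).symm
    have hJc : Continuous fun s => ∫ y, g y * v (y, s) := by
      simp_rw [hJ]
      refine continuous_parametric_integral_of_continuous (f := fun s y => g y * v (y, s))
        ?_ isCompact_Icc
      have := g.continuous
      have := h.cont_v
      simp only [Function.uncurry_def]
      fun_prop
    have hlow : T * (a / 2 * I) ≤ ∫ s in Ioc 0 T, ∫ y, g y * v (y, s) := by
      have hc : ∫ s in Ioc 0 T, a / 2 * I = T * (a / 2 * I) := by simp [hT.le]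
      rw [← hc]
      refine setIntegral_mono_on (integrableOn_const (by simp)) hJc.integrableOn_Ioc measurableSet_Ioc fun s hs => ?_
      rw [hI, ← integral_const_mul]
      have hvs : Continuous fun y => v (y, s) := by have := h.cont_v; fun_prop
      refine integral_mono (g.integrable.const_mul _)
        ((g.continuous.mul hvs).integrable_of_hasCompactSupport g.hasCompactSupport.mul_right)
        fun y => ?_
      by_cases hy : dist y x₀ < δ
      · rw [mul_comm]
        refine mul_le_mul_of_nonneg_left (hball ?_).le g.nonneg
        rw [Prod.dist_eq]
        refine max_lt hy ?_
        rw [Real.dist_eq, sub_zero, abs_of_pos hs.1]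
        exact hs.2.trans_lt hTδ
      · have : g y = 0 := g.zero_of_le_dist (by
          rw [show g.rOut = δ / 2 from rfl]; linarith [not_lt.1 hy])
        simp [this]
    have hup : ‖∫ s in Ioc 0 T, ∫ y, (deriv g y * (T - s) * w (y, s) -
        f (y, s) * (g y * (T - s)))‖ ≤ (T * (M + F)) * (2 * δ) * T := by
      have h1 := norm_setIntegral_le_of_norm_le_const (μ := volume) (s := Ioc 0 T)
        (C := (T * (M + F)) * (2 * δ)) (f := fun s => ∫ y, (deriv g y * (T - s) * w (y, s) -
        f (y, s) * (g y * (T - s)))) (by simp) fun s hs => ?_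
      · simpa [hT.le] using h1
      rw [← setIntegral_eq_integral_of_forall_compl_eq_zero (s := Icc (x₀ - δ) (x₀ + δ))
        fun y hy => by rw [hgfar y hy, hg'far y hy]; ring]
      have h2 := norm_setIntegral_le_of_norm_le_const (μ := volume) (s := Icc (x₀ - δ) (x₀ + δ))
        (C := T * (M + F)) (f := fun y => (deriv g y * (T - s) * w (y, s) -
        f (y, s) * (g y * (T - s)))) (by simp) fun y hy => ?_
      · refine h2.trans_eq ?_
        rw [Real.volume_real_Icc_of_le (by linarith)]
        ring
      have e1 := hM (y, s) ⟨hy, hs.1.le, hs.2.trans hT1⟩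
      have e2 := hF y s ⟨hs.1, hs.2.trans hT1⟩
      rw [show deriv g y * (T - s) * w (y, s) - f (y, s) * (g y * (T - s)) =
        (T - s) * (deriv g y * w (y, s) - f (y, s) * g y) by ring, norm_mul]
      have e3 : ‖f (y, s) * g y‖ ≤ F := by
        rw [norm_mul, Real.norm_eq_abs, Real.norm_eq_abs, abs_of_nonneg g.nonneg]
        exact (mul_le_of_le_one_right (abs_nonneg _) g.le_one).trans e2
      refine mul_le_mul ?_ ((norm_sub_le _ _).trans (add_le_add e1 e3)) (norm_nonneg _) hT.le
      rw [Real.norm_eq_abs, abs_of_nonneg (by linarith [hs.2])]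
      linarith [hs.1]
    simp only [neg_mul, integral_neg] at hweak
    rw [← hweak, norm_neg] at hup
    have := hlow.trans ((le_abs_self _).trans hup)
    refine le_of_mul_le_mul_left ?_ hT
    linarith
  have hlim : Tendsto (fun T : ℝ => (M + F) * (2 * δ) * T) (nhdsWithin 0 (Ioi 0)) (nhds 0) := by
    have : ContinuousAt (fun T : ℝ => (M + F) * (2 * δ) * T) 0 := by fun_prop
    simpa using this.tendsto.mono_left nhdsWithin_le_nhds
  have : a / 2 * I ≤ 0 := by
    refine ge_of_tendsto hlim ?_
    filter_upwards [Ioo_mem_nhdsGT hδ, Ioo_mem_nhdsGT one_pos] with T h1 h2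
    exact key T h1.1 h1.2 h2.2.le
  nlinarith

lemma IsWeakHeatSol.initial_eq_zero {v w f : ℝ × ℝ → ℝ} (h : IsWeakHeatSol v w f) (x : ℝ) :
    v (x, 0) = 0 :=
  le_antisymm (h.initial_nonpos x) (by simpa using h.neg.initial_nonpos x)

open scoped Topology in
/-- Comparison principle: if `g ≥ 0` can be touched from above by smooth functions `e` such that
`f ≥ -(e_t - e_xx)` wherever `v + g` is negative, then `v + g ≥ 0`. -/
lemma IsWeakHeatSol.add_nonneg {v w f g : ℝ × ℝ → ℝ} (h : IsWeakHeatSol v w f)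
    (hbdd : ∀ T > 0, ∃ C, ∀ x, ∀ t ∈ Icc (0 : ℝ) T, |v (x, t)| ≤ C)
    (hg0 : ∀ q, 0 ≤ g q) (hgc : ContinuousOn g (univ ×ˢ Ici 0))
    (hg : ∀ x₀ t₀, 0 < t₀ → v (x₀, t₀) + g (x₀, t₀) < 0 → ∃ e et ex exx : ℝ → ℝ → ℝ,
      HasParabolicDerivs e et ex exx ∧
      ContinuousAt (fun q : ℝ × ℝ => et q.1 q.2 - exx q.1 q.2) (x₀, t₀) ∧
      (∀ x, ∀ t > 0, g (x, t) ≤ e x t) ∧ e x₀ t₀ = g (x₀, t₀) ∧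
      ∀ ε > 0, ∀ᶠ q in 𝓝 (x₀, t₀), -(et x₀ t₀ - exx x₀ t₀) - ε ≤ f q)
    {x t : ℝ} (ht : 0 ≤ t) : 0 ≤ v (x, t) + g (x, t) := by
  by_contra! hneg
  have ht0 : 0 < t := by
    refine ht.lt_of_ne fun h0 => ?_
    subst h0
    linarith [h.initial_eq_zero x, hg0 (x, 0)]
  obtain ⟨μ, hμ⟩ : ∃ μ, μ = -(v (x, t) + g (x, t)) := ⟨_, rfl⟩
  have hμ0 : 0 < μ := by linarith
  obtain ⟨η, hη⟩ : ∃ η, η = μ / (4 * t) := ⟨_, rfl⟩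
  have hη0 : 0 < η := by rw [hη]; positivity
  have hηt : η * t = μ / 4 := by rw [hη]; field_simp
  obtain ⟨κ, hκ⟩ : ∃ κ, κ = min (η / 8) (μ / (4 * (x ^ 2 + 1))) := ⟨_, rfl⟩
  have hκ0 : 0 < κ := by rw [hκ]; positivity
  have hκη : κ ≤ η / 8 := hκ ▸ min_le_left _ _
  have hκx : κ * x ^ 2 ≤ μ / 4 := by
    have h1 : κ ≤ μ / (4 * (x ^ 2 + 1)) := hκ ▸ min_le_right _ _
    rw [le_div_iff₀ (by positivity)] at h1
    linarith
  obtain ⟨C, hC⟩ := hbdd t ht0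
  obtain ⟨R, hR⟩ : ∃ R, R = |x| + 1 + |C| / κ := ⟨_, rfl⟩
  have hCκ : 0 ≤ |C| / κ := by positivity
  have hR1 : 1 ≤ R := by linarith [abs_nonneg x]
  have hRC : C < κ * R ^ 2 := by
    have h1 : |C| < κ * R := by
      rw [← div_lt_iff₀' hκ0]
      linarith [abs_nonneg x]
    nlinarith [le_abs_self C, mul_pos hκ0 (by linarith : 0 < R)]
  set H : ℝ × ℝ → ℝ := fun q => v q + g q + (η * q.2 + κ * q.1 ^ 2) with hH
  have hHc : ContinuousOn H (Icc (-R) R ×ˢ Icc 0 t) :=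
    (h.cont_v.continuousOn.add (hgc.mono (prod_mono (subset_univ _) Icc_subset_Ici_self))).add
      (by fun_prop)
  have hxR : x ∈ Icc (-R) R := by
    rw [mem_Icc, ← abs_le]
    linarith
  obtain ⟨⟨x₀, t₀⟩, hq, hmin⟩ := (isCompact_Icc.prod isCompact_Icc).exists_isMinOn
    ⟨(x, t), hxR, ht0.le, le_rfl⟩ hHc
  have hHneg : H (x₀, t₀) < 0 := by
    refine lt_of_le_of_lt (hmin (show (x, t) ∈ _ from ⟨hxR, ht0.le, le_rfl⟩)) ?_
    simp only [hH]
    linarith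
  simp only [hH] at hHneg
  have hx₀ := hq.1
  have ht₀ := hq.2
  simp only [mem_Icc] at hx₀ ht₀
  have hκx₀ : 0 ≤ κ * x₀ ^ 2 := by positivity
  have hηt₀ : 0 ≤ η * t₀ := mul_nonneg hη0.le ht₀.1
  have ht₀pos : 0 < t₀ := by
    refine ht₀.1.lt_of_ne fun h0 => ?_
    subst h0
    linarith [h.initial_eq_zero x₀, hg0 (x₀, 0)]
  have hx₀R : |x₀| < R := by
    by_contra! hge
    have h1 : R ^ 2 ≤ x₀ ^ 2 := by
      rw [← sq_abs x₀]
      exact pow_le_pow_left₀ (by linarith) hge 2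
    have h2 := mul_le_mul_of_nonneg_left h1 hκ0.le
    linarith [hg0 (x₀, t₀), (abs_le.1 (hC x₀ t₀ hq.2)).1]
  obtain ⟨e, et, ex, exx, he, hec, hge, he0, hf⟩ := hg x₀ t₀ ht₀pos (by linarith)
  have hφ : HasParabolicDerivs (fun x t => -e x t - (η * t + κ * x ^ 2))
      (fun x t => -et x t - η) (fun x t => -ex x t - 2 * κ * x) (fun x t => -exx x t - 2 * κ) := by
    refine ⟨fun x t ht => ?_, fun x t ht => ?_, fun x t ht => ?_,
      he.continuousOn.neg.sub (by fun_prop)⟩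
    · refine (he.hasDerivAt_t x t ht).neg.sub ?_
      simpa using ((hasDerivAt_id t).const_mul η).add_const (κ * x ^ 2)
    · refine (he.hasDerivAt_x x t ht).neg.sub ?_
      convert! ((hasDerivAt_pow 2 x).const_mul κ).const_add (η * t) using 1
      simp; ring
    · refine (he.hasDerivAt_xx x t ht).neg.sub ?_
      simpa using (hasDerivAt_id x).const_mul (2 * κ)
  have hfin := h.le_of_touching hφ ht₀pos (m := -(et x₀ t₀ - exx x₀ t₀) - η / 2) ?_
    (hf _ (by positivity)) ?_
  · linarith
  · refine (hec.neg.add (continuousAt_const (y := 2 * κ - η))).congr (.of_forall fun q => ?_)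
    simp only [Pi.add_apply, Pi.neg_apply]
    ring
  · have h1 : ∀ᶠ q : ℝ × ℝ in 𝓝 (x₀, t₀), 0 < q.2 :=
      continuous_snd.continuousAt.eventually (lt_mem_nhds ht₀pos)
    have h2 : ∀ᶠ q : ℝ × ℝ in 𝓝 (x₀, t₀), |q.1| < R :=
      (by fun_prop : ContinuousAt (fun q : ℝ × ℝ => |q.1|) (x₀, t₀)).eventually
        (gt_mem_nhds hx₀R)
    filter_upwards [h1, h2] with q hq1 hq2 hqt
    have h3 := hmin (show q ∈ _ from ⟨abs_le.1 hq2.le, hq1.le, hqt.trans ht₀.2⟩)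
    have h4 := hge q.1 q.2 hq1
    simp only [hH, mem_ofPred_eq] at h3
    rw [he0]
    linarith

/-- The unnormalised tail `∫_η^∞ e^{-ζ²/4} dζ` of a Gaussian. -/
def gaussTail (η : ℝ) : ℝ := ∫ ζ in Ioi η, Real.exp (-ζ ^ 2 / 4)

lemma integrable_exp_neg_sq_div_four : Integrable fun ζ : ℝ => Real.exp (-ζ ^ 2 / 4) := by
  convert! integrable_exp_neg_mul_sq (b := 1 / 4) (by norm_num) using 3
  ring

lemma hasDerivAt_gaussTail (η : ℝ) : HasDerivAt gaussTail (-Real.exp (-η ^ 2 / 4)) η := by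
  have hc : Continuous fun ζ : ℝ => Real.exp (-ζ ^ 2 / 4) := by fun_prop
  have h1 : gaussTail = fun η => (∫ ζ in Ioi 0, Real.exp (-ζ ^ 2 / 4))
      - ∫ ζ in (0 : ℝ)..η, Real.exp (-ζ ^ 2 / 4) := by
    funext η
    have := intervalIntegral.integral_interval_add_Ioi (a := 0) (b := η)
      integrable_exp_neg_sq_div_four.integrableOn integrable_exp_neg_sq_div_four.integrableOn
    rw [gaussTail]
    linarith
  rw [h1]
  exact (hc.integral_hasStrictDerivAt 0 η).hasDerivAt.const_sub _

lemma continuous_gaussTail : Continuous gaussTail :=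
  continuous_iff_continuousAt.2 fun η => (hasDerivAt_gaussTail η).continuousAt

lemma strictAnti_gaussTail : StrictAnti gaussTail :=
  strictAnti_of_deriv_neg fun η => by
    rw [(hasDerivAt_gaussTail η).deriv]
    exact neg_neg_of_pos (Real.exp_pos _)

lemma gaussTail_pos (η : ℝ) : 0 < gaussTail η :=
  lt_of_le_of_lt (setIntegral_nonneg measurableSet_Ioi fun _ _ => (Real.exp_pos _).le)
    (strictAnti_gaussTail (lt_add_one η))

/-- The amplitude of the self-similar solution `ψ`. -/
def psiCoeff (α β : ℝ) : ℝ := α * β / 2 * Real.exp (α ^ 2 / 4)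

lemma psiCoeff_pos {α β : ℝ} (hα : 0 < α) (hβ : 0 < β) : 0 < psiCoeff α β := by
  unfold psiCoeff
  positivity

lemma psi_of_pos {α β x t : ℝ} (ht : 0 < t) :
    psi α β x t = psiCoeff α β * gaussTail (max (|x| / √t) α) := if_pos ht

lemma psi_of_nonpos {α β x t : ℝ} (ht : t ≤ 0) : psi α β x t = 0 := if_neg ht.not_gt

lemma psi_pos {α β x t : ℝ} (hα : 0 < α) (hβ : 0 < β) (ht : 0 < t) : 0 < psi α β x t := by
  rw [psi_of_pos ht]
  exact mul_pos (psiCoeff_pos hα hβ) (gaussTail_pos _)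

lemma psi_nonneg {α β : ℝ} (hα : 0 < α) (hβ : 0 < β) (x t : ℝ) : 0 ≤ psi α β x t := by
  rcases lt_or_ge 0 t with ht | ht
  · exact (psi_pos hα hβ ht).le
  · exact (psi_of_nonpos ht).ge

lemma psi_le {α β : ℝ} (hα : 0 < α) (hβ : 0 < β) (x t : ℝ) :
    psi α β x t ≤ psiCoeff α β * gaussTail α := by
  have hc := psiCoeff_pos hα hβ
  rcases lt_or_ge 0 t with ht | ht
  · rw [psi_of_pos ht]
    exact mul_le_mul_of_nonneg_left (strictAnti_gaussTail.antitone (le_max_right _ _)) hc.le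
  · rw [psi_of_nonpos ht]
    exact (mul_pos hc (gaussTail_pos α)).le

lemma measurable_psi (α β : ℝ) : Measurable fun q : ℝ × ℝ => psi α β q.1 q.2 := by
  refine Measurable.ite (measurableSet_lt measurable_const measurable_snd) ?_ measurable_const
  exact (continuous_gaussTail.measurable.comp (f := fun q : ℝ × ℝ => max (|q.1| / √q.2) α)
    (by fun_prop)).const_mul (psiCoeff α β)

lemma continuousOn_psi (α β : ℝ) :
    ContinuousOn (fun q : ℝ × ℝ => psi α β q.1 q.2) {q | 0 < q.2} := by
  have : ContinuousOn (fun q : ℝ × ℝ => psiCoeff α β * gaussTail (max (|q.1| / √q.2) α))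
      {q | 0 < q.2} := by
    refine continuousOn_const.mul (continuous_gaussTail.comp_continuousOn ?_)
    refine ContinuousOn.sup (ContinuousOn.div (by fun_prop) (by fun_prop) fun q hq => ?_)
      continuousOn_const
    exact (Real.sqrt_pos.2 hq).ne'
  exact this.congr fun q hq => psi_of_pos hq

lemma psi_mono {α β : ℝ} (hα : 0 < α) (hβ : 0 < β) (x : ℝ) : Monotone (psi α β x) := by
  intro s t hst
  rcases lt_or_ge 0 s with hs | hs
  · rw [psi_of_pos hs, psi_of_pos (hs.trans_le hst)]
    refine mul_le_mul_of_nonneg_left (strictAnti_gaussTail.antitone ?_) (psiCoeff_pos hα hβ).le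
    have := Real.sqrt_pos.2 hs
    gcongr
  · rw [psi_of_nonpos hs]
    exact psi_nonneg hα hβ x t

lemma hasParabolicDerivs_gaussTail {k : ℝ} (hk : k ^ 2 = 1) (c : ℝ) :
    HasParabolicDerivs (fun x t => c * gaussTail (k * x / √t))
      (fun x t => c * k * x / (2 * t * √t) * Real.exp (-(x ^ 2 / t) / 4))
      (fun x t => -(c * k / √t * Real.exp (-(x ^ 2 / t) / 4)))
      (fun x t => c * k * x / (2 * t * √t) * Real.exp (-(x ^ 2 / t) / 4)) := by
  have hexp : ∀ x t : ℝ, 0 < t → -(k * x / √t) ^ 2 / 4 = -(x ^ 2 / t) / 4 := by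
    intro x t ht
    rw [div_pow, mul_pow, hk, Real.sq_sqrt ht.le, one_mul]
  refine ⟨fun x t ht => ?_, fun x t ht => ?_, fun x t ht => ?_, ?_⟩
  · have hs := Real.sqrt_pos.2 ht
    have h1 : HasDerivAt (fun s => k * x / √s) (-(k * x) / (2 * t * √t)) t := by
      convert! (hasDerivAt_const t (k * x)).div (Real.hasDerivAt_sqrt ht.ne') hs.ne' using 1
      rw [Real.sq_sqrt ht.le]
      field_simp
      ring
    have h2 := ((hasDerivAt_gaussTail (k * x / √t)).comp t h1).const_mul c
    rw [hexp x t ht] at h2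
    convert! h2 using 1
    ring
  · have h1 : HasDerivAt (fun y => k * y / √t) (k / √t) x := by
      simpa using ((hasDerivAt_id x).const_mul k).div_const √t
    have h2 := ((hasDerivAt_gaussTail (k * x / √t)).comp x h1).const_mul c
    rw [hexp x t ht] at h2
    convert! h2 using 1
    ring
  · have h1 : HasDerivAt (fun y : ℝ => -(y ^ 2 / t) / 4) (-(x / (2 * t))) x := by
      convert! (((hasDerivAt_pow 2 x).div_const t).neg).div_const 4 using 1
      simp
      ring
    convert! ((h1.exp).const_mul (c * k / √t)).neg using 1
    ring
  · refine continuousOn_const.mul (continuous_gaussTail.comp_continuousOn ?_)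
    refine ContinuousOn.div (by fun_prop) (by fun_prop) fun q hq => ?_
    exact (Real.sqrt_pos.2 hq).ne'

/-- `ψ` is a minimum of caloric functions. -/
lemma exists_caloric_touching_psi {α β : ℝ} (hα : 0 < α) (hβ : 0 < β) (x₀ : ℝ) {t₀ : ℝ}
    (ht₀ : 0 < t₀) : ∃ e et ex : ℝ → ℝ → ℝ, HasParabolicDerivs e et ex et ∧
      (∀ x, ∀ t > 0, psi α β x t ≤ e x t) ∧ e x₀ t₀ = psi α β x₀ t₀ := by
  have hc := psiCoeff_pos hα hβ
  rcases le_total (|x₀| / √t₀) α with h | h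
  · refine ⟨fun _ _ => psiCoeff α β * gaussTail α, fun _ _ => 0, fun _ _ => 0,
      ⟨fun x t _ => hasDerivAt_const _ _, fun x t _ => hasDerivAt_const _ _,
        fun x t _ => hasDerivAt_const _ _, continuousOn_const⟩, fun x t _ => psi_le hα hβ x t, ?_⟩
    rw [psi_of_pos ht₀, max_eq_right h]
  · obtain ⟨k, hk, hkx⟩ : ∃ k : ℝ, k ^ 2 = 1 ∧ k * x₀ = |x₀| := by
      rcases abs_choice x₀ with h | h
      · exact ⟨1, by norm_num, by rw [h, one_mul]⟩
      · exact ⟨-1, by norm_num, by rw [h, neg_one_mul]⟩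
    refine ⟨_, _, _, hasParabolicDerivs_gaussTail hk (psiCoeff α β), fun x t ht => ?_, ?_⟩
    · rw [psi_of_pos ht]
      refine mul_le_mul_of_nonneg_left (strictAnti_gaussTail.antitone ?_) hc.le
      refine le_max_of_le_left (div_le_div_of_nonneg_right ?_ (Real.sqrt_nonneg t))
      have hk1 : |k| = 1 := by
        rw [← sq_eq_sq₀ (abs_nonneg k) zero_le_one, sq_abs, hk, one_pow]
      calc k * x ≤ |k * x| := le_abs_self _
        _ = |x| := by rw [abs_mul, hk1, one_mul]
    · rw [psi_of_pos ht₀, max_eq_left h, hkx]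

lemma HasParabolicDerivs.one_sub_exp_mul {e et ex : ℝ → ℝ → ℝ}
    (h : HasParabolicDerivs e et ex et) :
    HasParabolicDerivs (fun x t => (1 - Real.exp (-t)) * e x t)
      (fun x t => Real.exp (-t) * e x t + (1 - Real.exp (-t)) * et x t)
      (fun x t => (1 - Real.exp (-t)) * ex x t) (fun x t => (1 - Real.exp (-t)) * et x t) := by
  refine ⟨fun x t ht => ?_, fun x t ht => (h.hasDerivAt_x x t ht).const_mul _,
    fun x t ht => (h.hasDerivAt_xx x t ht).const_mul _, ?_⟩
  · have h1 : HasDerivAt (fun s : ℝ => 1 - Real.exp (-s)) (Real.exp (-t)) t := by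
      simpa using ((hasDerivAt_neg t).exp).const_sub 1
    exact h1.mul (h.hasDerivAt_t x t ht)
  · exact ContinuousOn.mul (by fun_prop) h.continuousOn

/-- The barrier `(1 - e^{-t}) ψ` is continuous up to `t = 0`. -/
lemma continuousOn_one_sub_exp_mul_psi {α β : ℝ} (hα : 0 < α) (hβ : 0 < β) :
    ContinuousOn (fun q : ℝ × ℝ => (1 - Real.exp (-q.2)) * psi α β q.1 q.2)
      (univ ×ˢ Ici 0) := by
  rintro ⟨x, t⟩ ⟨-, ht⟩
  rcases (show 0 ≤ t from ht).eq_or_lt with rfl | ht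
  · have h0 : Tendsto (fun q : ℝ × ℝ => (1 - Real.exp (-q.2)) * (psiCoeff α β * gaussTail α))
        (nhdsWithin (x, 0) (univ ×ˢ Ici 0)) (nhds 0) := by
      have : Continuous fun q : ℝ × ℝ =>
          (1 - Real.exp (-q.2)) * (psiCoeff α β * gaussTail α) := by fun_prop
      simpa [ContinuousWithinAt] using
        this.continuousWithinAt (s := univ ×ˢ Ici 0) (x := (x, (0 : ℝ)))
    have hexp : ∀ q ∈ (univ ×ˢ Ici 0 : Set (ℝ × ℝ)), 0 ≤ 1 - Real.exp (-q.2) := fun q hq => by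
      have := Real.exp_le_one_iff.2 (neg_nonpos.2 (show 0 ≤ q.2 from hq.2))
      linarith
    simp only [ContinuousWithinAt, neg_zero, Real.exp_zero, sub_self, zero_mul]
    refine tendsto_of_tendsto_of_tendsto_of_le_of_le' tendsto_const_nhds h0 ?_ ?_
    · filter_upwards [self_mem_nhdsWithin] with q hq
        using mul_nonneg (hexp q hq) (psi_nonneg hα hβ _ _)
    · filter_upwards [self_mem_nhdsWithin] with q hq
        using mul_le_mul_of_nonneg_left (psi_le hα hβ _ _) (hexp q hq)
  · refine ContinuousAt.continuousWithinAt ?_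
    refine ContinuousAt.mul (by fun_prop) ?_
    exact (continuousOn_psi α β).continuousAt
      ((isOpen_lt continuous_const continuous_snd).mem_nhds ht)

lemma IsWeakSolution.precipitation_mem_Icc {α β ustar : ℝ} {u p : ℝ → ℝ → ℝ}
    (h : IsWeakSolution α β ustar u p) (x : ℝ) {t : ℝ} (ht : 0 ≤ t) : p x t ∈ Icc (0 : ℝ) 1 := by
  obtain ⟨h1, h2, h3⟩ := h.2.2.2.1 x t ht
  rcases lt_trichotomy (sSup ((fun s => u x s) '' Icc 0 t)) ustar with hlt | heq | hgt
  · simp [h1 hlt]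
  · exact h2 heq
  · simp [h3 hgt]

/-- The difference `u - ψ`, extended to negative times by its initial value. -/
def uSubPsi (α β : ℝ) (u : ℝ → ℝ → ℝ) (q : ℝ × ℝ) : ℝ :=
  u q.1 (max q.2 0) - psi α β q.1 (max q.2 0)

lemma uSubPsi_of_nonneg {α β : ℝ} {u : ℝ → ℝ → ℝ} {x t : ℝ} (ht : 0 ≤ t) :
    uSubPsi α β u (x, t) = u x t - psi α β x t := by
  simp [uSubPsi, ht]

lemma AuxReg.exists_abs_uSubPsi_le {α β : ℝ} {u w : ℝ → ℝ → ℝ} (h : AuxReg α β u w) :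
    ∀ T > 0, ∃ C, ∀ x, ∀ t ∈ Icc (0 : ℝ) T, |uSubPsi α β u (x, t)| ≤ C := by
  intro T hT
  obtain ⟨C, hC⟩ := h.2.2.2 T hT
  refine ⟨C, fun x t ht => ?_⟩
  rw [uSubPsi_of_nonneg ht.1]
  exact (hC x t ht).1

lemma IsWeakSolution.isWeakHeatSol {α β ustar : ℝ} (hα : 0 < α) (hβ : 0 < β)
    {u p w : ℝ → ℝ → ℝ} (h : IsWeakSolution α β ustar u p) (hreg : AuxReg α β u w)
    (hweak : WeakForm α β u p w) :
    IsWeakHeatSol (uSubPsi α β u) (fun q => w q.1 (max q.2 0))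
      (fun q => -(p q.1 q.2 * (uSubPsi α β u q + psi α β q.1 q.2))) := by
  have hmax : Continuous fun q : ℝ × ℝ => (q.1, max q.2 0) := by fun_prop
  have hmem : ∀ q : ℝ × ℝ, (q.1, max q.2 0) ∈ (univ ×ˢ Ici 0 : Set (ℝ × ℝ)) := fun q =>
    ⟨mem_univ _, le_max_right q.2 0⟩
  have hcv : Continuous (uSubPsi α β u) := hreg.2.1.comp_continuous hmax hmem
  refine ⟨hcv, hreg.2.2.1.comp_continuous hmax hmem,
    fun x t => hreg.1 _ (le_max_right t 0) x,
    (h.2.2.1.mul (hcv.measurable.add (measurable_psi α β))).neg, fun T hT => ?_,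
    fun T hT φ φt φx hφ => ?_⟩
  · obtain ⟨C, hC⟩ := hreg.exists_abs_uSubPsi_le T hT
    refine ⟨C + psiCoeff α β * gaussTail α, fun x t ht => ?_⟩
    have hp := h.precipitation_mem_Icc x ht.1.le
    rw [abs_neg, abs_mul, abs_of_nonneg hp.1]
    refine (mul_le_of_le_one_left (abs_nonneg _) hp.2).trans ((abs_add_le _ _).trans ?_)
    rw [abs_of_nonneg (psi_nonneg hα hβ x t)]
    exact add_le_add (hC x t ⟨ht.1.le, ht.2⟩) (psi_le hα hβ x t)
  · have hl : (∫ t in Ioc (0 : ℝ) T, ∫ x : ℝ, φt x t * uSubPsi α β u (x, t))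
        = ∫ t in Ioc (0 : ℝ) T, ∫ x : ℝ, φt x t * (u x t - psi α β x t) := by
      refine setIntegral_congr_fun measurableSet_Ioc fun t ht => ?_
      simp only [uSubPsi_of_nonneg ht.1.le]
    rw [hl, hweak T hT φ φt φx hφ]
    refine setIntegral_congr_fun measurableSet_Ioc fun t ht => ?_
    simp only [uSubPsi_of_nonneg ht.1.le, max_eq_left ht.1.le]
    congr 1
    funext x
    ring

/-- Lower bound for weak solutions, by comparison of `u - ψ` with `-(1 - e^{-t}) ψ`. -/
lemma IsWeakSolution.one_sub_exp_mul_psi_le {α β ustar : ℝ} (hα : 0 < α) (hβ : 0 < β)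
    {u p : ℝ → ℝ → ℝ} (h : IsWeakSolution α β ustar u p) (x : ℝ) {t : ℝ} (ht : 0 < t) :
    Real.exp (-t) * psi α β x t ≤ u x t := by
  obtain ⟨w, hreg, hweak⟩ := h.2.2.2.2.2
  have hv := h.isWeakHeatSol hα hβ hreg hweak
  have hg0 : ∀ q : ℝ × ℝ, 0 ≤ (1 - Real.exp (-q.2)) * psi α β q.1 q.2 := by
    intro q
    rcases lt_or_ge 0 q.2 with hq | hq
    · have := Real.exp_le_one_iff.2 (neg_nonpos.2 hq.le)
      exact mul_nonneg (by linarith) (psi_nonneg hα hβ _ _)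
    · rw [psi_of_nonpos hq, mul_zero]
  have key := hv.add_nonneg hreg.exists_abs_uSubPsi_le hg0
    (continuousOn_one_sub_exp_mul_psi hα hβ) ?_ (x := x) ht.le
  · rw [uSubPsi_of_nonneg ht.le] at key
    simp only at key
    linarith
  intro x₀ t₀ ht₀ hneg
  obtain ⟨e, et, ex, he, hle, heq⟩ := exists_caloric_touching_psi hα hβ x₀ ht₀
  have hopen : {q : ℝ × ℝ | 0 < q.2} ∈ nhds (x₀, t₀) :=
    (isOpen_lt continuous_const continuous_snd).mem_nhds ht₀
  have hψc : ContinuousAt (fun q : ℝ × ℝ => psi α β q.1 q.2) (x₀, t₀) :=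
    (continuousOn_psi α β).continuousAt hopen
  have hexpc : ContinuousAt (fun q : ℝ × ℝ => Real.exp (-q.2)) (x₀, t₀) := by fun_prop
  refine ⟨_, _, _, _, he.one_sub_exp_mul, ?_, fun x t ht => ?_, ?_, fun ε hε => ?_⟩
  · simp only [add_sub_cancel_right]
    exact hexpc.mul (he.continuousOn.continuousAt hopen)
  · have := Real.exp_le_one_iff.2 (neg_nonpos.2 (show 0 ≤ t from ht.le))
    exact mul_le_mul_of_nonneg_left (hle x t ht) (by linarith)
  · simp only [heq]
  · simp only [add_sub_cancel_right, heq]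
    have hz : ∀ᶠ q : ℝ × ℝ in nhds (x₀, t₀),
        uSubPsi α β u q + (1 - Real.exp (-q.2)) * psi α β q.1 q.2 < 0 :=
      (hv.cont_v.continuousAt.add ((continuousAt_const.sub hexpc).mul hψc)).eventually
        (gt_mem_nhds hneg)
    have hd : ∀ᶠ q : ℝ × ℝ in nhds (x₀, t₀),
        Real.exp (-q.2) * psi α β q.1 q.2 < Real.exp (-t₀) * psi α β x₀ t₀ + ε :=
      (hexpc.mul hψc).eventually (gt_mem_nhds (by simpa using hε))
    filter_upwards [hz, hd, hopen] with q hq1 hq2 hq3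
    have hp := h.precipitation_mem_Icc q.1 (t := q.2) (le_of_lt hq3)
    have h1 : p q.1 q.2 * (uSubPsi α β u q + psi α β q.1 q.2)
        ≤ p q.1 q.2 * (Real.exp (-q.2) * psi α β q.1 q.2) :=
      mul_le_mul_of_nonneg_left (by linarith) hp.1
    have h2 : p q.1 q.2 * (Real.exp (-q.2) * psi α β q.1 q.2)
        ≤ Real.exp (-q.2) * psi α β q.1 q.2 :=
      mul_le_of_le_one_left (mul_nonneg (Real.exp_pos _).le (psi_nonneg hα hβ _ _)) hp.2
    linarith

lemma IsWeakSolution.pos {α β ustar : ℝ} (hα : 0 < α) (hβ : 0 < β)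
    {u p : ℝ → ℝ → ℝ} (h : IsWeakSolution α β ustar u p) (x : ℝ) {t : ℝ} (ht : 0 < t) :
    0 < u x t :=
  (mul_pos (Real.exp_pos _) (psi_pos hα hβ ht)).trans_le (h.one_sub_exp_mul_psi_le hα hβ x ht)

lemma IsWeakSolution.initial_eq {α β ustar : ℝ} (hα : 0 < α) (hβ : 0 < β)
    {u p : ℝ → ℝ → ℝ} (h : IsWeakSolution α β ustar u p) (x : ℝ) : u x 0 = psi α β x 0 := by
  obtain ⟨w, hreg, hweak⟩ := h.2.2.2.2.2
  have := (h.isWeakHeatSol hα hβ hreg hweak).initial_eq_zero x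
  rw [uSubPsi_of_nonneg le_rfl] at this
  linarith

lemma IsWeakSolution.le_psi {α β ustar : ℝ} (hα : 0 < α) (hβ : 0 < β)
    {u p : ℝ → ℝ → ℝ} (h : IsWeakSolution α β ustar u p) (x : ℝ) {t : ℝ} (ht : 0 ≤ t) :
    u x t ≤ psi α β x t := by
  obtain ⟨w, hreg, hweak⟩ := h.2.2.2.2.2
  have hv := h.isWeakHeatSol hα hβ hreg hweak
  have key := hv.neg.add_nonneg (g := fun _ => 0) (by simpa using hreg.exists_abs_uSubPsi_le)
    (fun _ => le_rfl) continuousOn_const ?_ (x := x) ht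
  · rw [uSubPsi_of_nonneg ht] at key
    linarith
  intro x₀ t₀ ht₀ _
  refine ⟨fun _ _ => 0, fun _ _ => 0, fun _ _ => 0, fun _ _ => 0,
    ⟨fun x t _ => hasDerivAt_const _ _, fun x t _ => hasDerivAt_const _ _,
      fun x t _ => hasDerivAt_const _ _, continuousOn_const⟩,
    continuousAt_const, fun _ _ _ => le_rfl, rfl, fun ε hε => ?_⟩
  filter_upwards [(isOpen_lt continuous_const continuous_snd).mem_nhds ht₀] with q hq
  have hq' : 0 < q.2 := hq
  have hp := h.precipitation_mem_Icc q.1 hq'.le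
  have hu := h.pos hα hβ q.1 hq'
  have h1 : uSubPsi α β u q + psi α β q.1 q.2 = u q.1 q.2 := by
    rw [show q = (q.1, q.2) from rfl, uSubPsi_of_nonneg hq'.le]
    ring
  rw [h1, neg_neg]
  have := mul_nonneg hp.1 hu.le
  linarith

/-- basic properties of weak solutions: `u(·,0) = ψ(·,0)`,
`0 < u ≤ ψ` for `t > 0`, and no precipitation in the region `|x| > α*·√t` when
`u* < Ψ(α)`, where `α*` is the unique number `> α` with `Ψ(α*) = u*`. -/
theorem weak_sol_basic_properties (α β ustar : ℝ) (hα : 0 < α) (hβ : 0 < β)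
    (hu : 0 < ustar) (u p : ℝ → ℝ → ℝ) (hsol : IsWeakSolution α β ustar u p) :
    (∀ x : ℝ, u x 0 = psi α β x 0) ∧
    (∀ x t : ℝ, 0 < t → 0 < u x t ∧ u x t ≤ psi α β x t) ∧
    (ustar < PsiP α β α →
      ∀ astar : ℝ, α < astar → PsiP α β astar = ustar →
        ∀ x t : ℝ, 0 < t → astar * Real.sqrt t < |x| → p x t = 0) := by
  refine ⟨hsol.initial_eq hα hβ,
    fun x t ht => ⟨hsol.pos hα hβ x ht, hsol.le_psi hα hβ x ht.le⟩,
    fun _ astar hastar hP x t ht hx => (hsol.2.2.2.1 x t ht.le).1 ?_⟩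
  have hlt : psi α β x t < ustar := by
    have h1 : astar < |x| / √t := (lt_div_iff₀ (Real.sqrt_pos.2 ht)).2 hx
    rw [psi_of_pos ht, max_eq_left (hastar.trans h1).le, ← hP]
    change _ < psiCoeff α β * gaussTail (max astar α)
    rw [max_eq_left hastar.le]
    exact mul_lt_mul_of_pos_left (strictAnti_gaussTail h1) (psiCoeff_pos hα hβ)
  refine lt_of_le_of_lt (csSup_le ((nonempty_Icc.2 ht.le).image _) ?_) hlt
  rintro _ ⟨s, hs, rfl⟩
  exact (hsol.le_psi hα hβ x hs.1).trans (psi_mono hα hβ x hs.2)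

end
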